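/- arXiv:2507.23316 — 2 statements merged into one kernel-verified Lean document; each statement's English description precedes it below -/
import Mathlib

section
/- For every lower semilinear diagonal δ ∈ 𝒟^LSL, Chatterjee's rank correlation never exceeds Spearman's rho: ξ(δ) ≤ ρ(δ). -/
open MeasureTheory Set

/-- A lower semilinear diagonal: nondecreasing, 2-Lipschitz on `[0,1]`, `δ 1 = 1`,
`t² ≤ δ t ≤ t` on `[0,1]`, `t ↦ δ t / t` nondecreasing on `(0,1]` and
`t ↦ δ t / t²` nonincreasing on `(0,1]`. -/
def IsLSL (δ : ℝ → ℝ) : Prop :=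
  MonotoneOn δ (Icc 0 1) ∧
  LipschitzOnWith 2 δ (Icc 0 1) ∧
  δ 1 = 1 ∧
  (∀ t ∈ Icc (0:ℝ) 1, t ^ 2 ≤ δ t ∧ δ t ≤ t) ∧
  MonotoneOn (fun t => δ t / t) (Ioc 0 1) ∧
  AntitoneOn (fun t => δ t / t ^ 2) (Ioc 0 1)

/-- Kendall's tau of the lower semilinear copula with diagonal `δ`. -/
noncomputable def tauLSL (δ : ℝ → ℝ) : ℝ := 4 * (∫ t in (0:ℝ)..1, (δ t) ^ 2 / t) - 1

/-- Spearman's rho of the lower semilinear copula with diagonal `δ`. -/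
noncomputable def rhoLSL (δ : ℝ → ℝ) : ℝ := 12 * (∫ t in (0:ℝ)..1, t * δ t) - 3

/-- Spearman's footrule of the lower semilinear copula with diagonal `δ`. -/
noncomputable def phiLSL (δ : ℝ → ℝ) : ℝ := 6 * (∫ t in (0:ℝ)..1, δ t) - 2

/-- Chatterjee's rank correlation of the lower semilinear copula with diagonal `δ`,
expressed through the a.e. derivative of `δ` (represented by `deriv δ`, which agrees
with the a.e. derivative almost everywhere since `δ` is Lipschitz on `[0,1]`). -/
noncomputable def xiLSL (δ : ℝ → ℝ) : ℝ :=
  tauLSL δ - 2 * ∫ t in (0:ℝ)..1,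
    (t * deriv δ t - δ t) * (2 * δ t - t * deriv δ t) / t

/-- The diagonal `u_a`: `u_a t = t²/a` for `t ≤ a`, `u_a t = t` otherwise (`u_0 t = t`). -/
noncomputable def uDiag (a : ℝ) (t : ℝ) : ℝ :=
  if a = 0 then t else if t ≤ a then t ^ 2 / a else t

/-- The diagonal `l_a`: `l_a t = a·t` for `t ≤ a`, `l_a t = t²` otherwise. -/
noncomputable def lDiag (a : ℝ) (t : ℝ) : ℝ := if t ≤ a then a * t else t ^ 2

namespace IsLSL

variable {δ : ℝ → ℝ}

lemma absolutelyContinuousOnInterval (hδ : IsLSL δ) :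
    AbsolutelyContinuousOnInterval δ 0 1 := by
  have h := hδ.2.1
  rw [← uIcc_of_le (zero_le_one' ℝ)] at h
  exact h.absolutelyContinuousOnInterval

lemma le_mul_deriv (hδ : IsLSL δ) {t : ℝ} (ht : t ∈ Ioo (0 : ℝ) 1)
    (hd : DifferentiableAt ℝ δ t) : δ t ≤ t * deriv δ t := by
  have ht0 := ht.1
  have hmem : Ioc (0 : ℝ) 1 ∈ nhds t := Ioc_mem_nhds ht.1 ht.2
  have h := hδ.2.2.2.2.1.derivWithin_nonneg (x := t)
  rw [derivWithin_of_mem_nhds hmem,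
    (hd.hasDerivAt.fun_div (hasDerivAt_id' t) ht0.ne').deriv] at h
  have h' := mul_nonneg h (sq_nonneg t)
  field_simp at h'
  linarith

lemma mul_deriv_le (hδ : IsLSL δ) {t : ℝ} (ht : t ∈ Ioo (0 : ℝ) 1)
    (hd : DifferentiableAt ℝ δ t) : t * deriv δ t ≤ 2 * δ t := by
  have ht0 := ht.1
  have hmem : Ioc (0 : ℝ) 1 ∈ nhds t := Ioc_mem_nhds ht.1 ht.2
  have h := hδ.2.2.2.2.2.derivWithin_nonpos (x := t)
  rw [derivWithin_of_mem_nhds hmem,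
    (hd.hasDerivAt.fun_div (hasDerivAt_pow 2 t) (pow_pos ht0 2).ne').deriv] at h
  have h' := mul_nonpos_of_nonpos_of_nonneg h (pow_pos ht0 3).le
  norm_num at h'
  field_simp at h'
  linarith

lemma ae_bounds_deriv (hδ : IsLSL δ) :
    ∀ᵐ t ∂volume.restrict (Icc (0 : ℝ) 1), t ∈ Ioo (0 : ℝ) 1 ∧ DifferentiableAt ℝ δ t ∧
      δ t ≤ t * deriv δ t ∧ t * deriv δ t ≤ 2 * δ t := by
  rw [← Measure.restrict_congr_set Ioo_ae_eq_Icc, ae_restrict_iff' measurableSet_Ioo]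
  filter_upwards [hδ.absolutelyContinuousOnInterval.ae_differentiableAt] with t h ht
  have hd := h (by rw [uIcc_of_le zero_le_one]; exact Ioo_subset_Icc_self ht)
  exact ⟨ht, hd, hδ.le_mul_deriv ht hd, hδ.mul_deriv_le ht hd⟩

lemma intervalIntegrable_sq_div (hδ : IsLSL δ) :
    IntervalIntegrable (fun t => δ t ^ 2 / t) volume 0 1 := by
  rw [intervalIntegrable_iff_integrableOn_Ioc_of_le zero_le_one]
  have hc : ContinuousOn (fun t => δ t ^ 2 / t) (Ioc 0 1) :=
    ((hδ.2.1.continuousOn.mono Ioc_subset_Icc_self).pow 2).div continuousOn_id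
      fun t ht => ht.1.ne'
  refine IntegrableOn.of_bound measure_Ioc_lt_top
    (hc.aestronglyMeasurable measurableSet_Ioc) 1 ?_
  refine (ae_restrict_iff' measurableSet_Ioc).2 (.of_forall fun t ht => ?_)
  have hb := hδ.2.2.2.1 t (Ioc_subset_Icc_self ht)
  have ht0 := ht.1
  rw [Real.norm_of_nonneg (by positivity), div_le_one ht0]
  nlinarith [ht.2, sq_nonneg t]

lemma intervalIntegrable_mul (hδ : IsLSL δ) :
    IntervalIntegrable (fun t => t * δ t) volume 0 1 := by
  apply ContinuousOn.intervalIntegrable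
  exact continuousOn_id.mul hδ.absolutelyContinuousOnInterval.continuousOn

/-- Integrating the derivative of `2 t² δ t - (δ t)²` over `[0,1]`. -/
lemma one_le_integral (hδ : IsLSL δ) :
    1 ≤ 6 * (∫ t in (0 : ℝ)..1, t * δ t) - 2 * ∫ t in (0 : ℝ)..1, δ t ^ 2 / t := by
  have hac := hδ.absolutelyContinuousOnInterval
  have hsq : AbsolutelyContinuousOnInterval (fun t : ℝ => 2 * t ^ 2) 0 1 :=
    ContDiffOn.absolutelyContinuousOnInterval (by fun_prop)
  have hΦ : AbsolutelyContinuousOnInterval (fun t => 2 * t ^ 2 * δ t - δ t * δ t) 0 1 :=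
    (hsq.mul hac).sub (hac.mul hac)
  have h0 : δ 0 = 0 := by
    have := hδ.2.2.2.1 0 (by simp)
    norm_num at this
    linarith
  have hI := hΦ.integral_deriv_eq_sub
  simp only [h0, hδ.2.2.1] at hI
  have h1 := hδ.intervalIntegrable_mul.const_mul 6
  have h2 := hδ.intervalIntegrable_sq_div.const_mul 2
  rw [← intervalIntegral.integral_const_mul, ← intervalIntegral.integral_const_mul,
    ← intervalIntegral.integral_sub h1 h2]
  calc (1 : ℝ) = ∫ t in (0 : ℝ)..1, deriv (fun t => 2 * t ^ 2 * δ t - δ t * δ t) t := by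
        rw [hI]; norm_num
    _ ≤ _ := ?_
  refine intervalIntegral.integral_mono_ae_restrict zero_le_one hΦ.intervalIntegrable_deriv
    (h1.sub h2) ?_
  filter_upwards [hδ.ae_bounds_deriv] with t ⟨ht, hd, hl, _⟩
  have ht0 := ht.1
  have hb := hδ.2.2.2.1 t (Ioo_subset_Icc_self ht)
  have hD := ((((hasDerivAt_pow 2 t).const_mul 2).mul hd.hasDerivAt).sub
    (hd.hasDerivAt.mul hd.hasDerivAt)).deriv
  have hdiv : δ t / t ≤ deriv δ t := by rw [div_le_iff₀ ht0]; linarith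
  have hkey := mul_le_mul_of_nonneg_left hdiv (sub_nonneg.2 hb.1)
  have hexp : (δ t - t ^ 2) * (δ t / t) = δ t ^ 2 / t - t * δ t := by
    field_simp
  refine hD.le.trans ?_
  norm_num
  linarith

lemma tauLSL_le_rhoLSL (hδ : IsLSL δ) : tauLSL δ ≤ rhoLSL δ := by
  have := hδ.one_le_integral
  unfold tauLSL rhoLSL
  linarith

lemma xiLSL_le_tauLSL (hδ : IsLSL δ) : xiLSL δ ≤ tauLSL δ := by
  have h : 0 ≤ ∫ t in (0 : ℝ)..1,
      (t * deriv δ t - δ t) * (2 * δ t - t * deriv δ t) / t := by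
    refine intervalIntegral.integral_nonneg_of_ae_restrict zero_le_one ?_
    filter_upwards [hδ.ae_bounds_deriv] with t ⟨ht, _, hl, hu⟩
    exact div_nonneg (mul_nonneg (sub_nonneg.2 hl) (sub_nonneg.2 hu)) ht.1.le
  unfold xiLSL
  linarith

end IsLSL

/-- For every lower semilinear diagonal, Chatterjee's rank correlation never exceeds
Spearman's rho. -/
theorem xi_le_rho (δ : ℝ → ℝ) (hδ : IsLSL δ) : xiLSL δ ≤ rhoLSL δ :=
  hδ.xiLSL_le_tauLSL.trans hδ.tauLSL_le_rhoLSL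
end

section
/- For a lower semilinear diagonal δ ∈ 𝒟^LSL, the identity ξ(δ) = ρ(δ) holds if and only if δ = l_a for some a ∈ [0,1]. -/
open MeasureTheory Set

namespace IsLSL

variable {δ : ℝ → ℝ}

/-- Almost everywhere on `(0,1)` a lower semilinear diagonal is differentiable, and monotonicity of
`δ t / t` and `δ t / t²` gives two-sided bounds on its derivative. -/
lemma ae_deriv_bounds (hδ : IsLSL δ) :
    ∀ᵐ t : ℝ, t ∈ Ioo (0:ℝ) 1 →
      HasDerivAt δ (deriv δ t) t ∧ 0 ≤ t * deriv δ t - δ t ∧ 0 ≤ 2 * δ t - t * deriv δ t := by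
  filter_upwards [hδ.absolutelyContinuousOnInterval.ae_differentiableAt] with t ht h01
  have hd : HasDerivAt δ (deriv δ t) t :=
    (ht (by simpa using Ioo_subset_Icc_self h01)).hasDerivAt
  have hpos : 0 < t := h01.1
  have hnhds : Ioc (0:ℝ) 1 ∈ nhds t := Ioc_mem_nhds h01.1 h01.2
  refine ⟨hd, ?_, ?_⟩
  · have h := hδ.2.2.2.2.1.derivWithin_nonneg (x := t)
    rw [derivWithin_of_mem_nhds hnhds, (hd.fun_div (hasDerivAt_id' t) hpos.ne').deriv,
      le_div_iff₀ (by positivity)] at h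
    linarith
  · have h := hδ.2.2.2.2.2.derivWithin_nonpos (x := t)
    rw [derivWithin_of_mem_nhds hnhds, (hd.fun_div (hasDerivAt_pow 2 t) (by positivity)).deriv,
      div_le_iff₀ (by positivity)] at h
    norm_num at h
    by_contra! hlt
    nlinarith [mul_pos hpos (neg_pos.2 hlt)]

lemma continuousOn (hδ : IsLSL δ) : ContinuousOn δ (Ioo 0 1) :=
  hδ.2.1.continuousOn.mono Ioo_subset_Icc_self

lemma intervalIntegrable_xi_integrand (hδ : IsLSL δ) :
    IntervalIntegrable (fun t => (t * deriv δ t - δ t) * (2 * δ t - t * deriv δ t) / t)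
      volume 0 1 := by
  refine hδ.intervalIntegrable_sq_div.mono_fun ?_ ?_
  · rw [uIoc_of_le zero_le_one, ← restrict_Ioo_eq_restrict_Ioc]
    have hδm : AEStronglyMeasurable δ (volume.restrict (Ioo 0 1)) :=
      hδ.continuousOn.aestronglyMeasurable measurableSet_Ioo
    have hDm : AEStronglyMeasurable (fun t => t * deriv δ t) (volume.restrict (Ioo 0 1)) :=
      (measurable_id.mul (measurable_deriv δ)).aestronglyMeasurable
    simp only [div_eq_mul_inv]
    exact ((hDm.sub hδm).mul ((hδm.const_mul 2).sub hDm)).mul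
      measurable_inv.aestronglyMeasurable
  · rw [uIoc_of_le zero_le_one, ← restrict_Ioo_eq_restrict_Ioc]
    filter_upwards [ae_restrict_mem measurableSet_Ioo, ae_restrict_of_ae hδ.ae_deriv_bounds]
      with t ht hb
    obtain ⟨-, hp, hq⟩ := hb ht
    have hpos : 0 < t := ht.1
    rw [Real.norm_of_nonneg (by positivity), Real.norm_of_nonneg (by positivity)]
    gcongr
    nlinarith

lemma absolutelyContinuousOnInterval_sq (hδ : IsLSL δ) :
    AbsolutelyContinuousOnInterval (fun t => (δ t - t ^ 2) ^ 2) 0 1 := by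
  have h : AbsolutelyContinuousOnInterval (fun t => δ t - t ^ 2) 0 1 :=
    hδ.absolutelyContinuousOnInterval.sub
      (contDiff_id.pow 2).contDiffOn.absolutelyContinuousOnInterval
  simpa only [sq, Pi.mul_def] using h.mul h

/-- The integrand of `ρ(δ) - ξ(δ)`, nonnegative almost everywhere. -/
noncomputable def gap (δ : ℝ → ℝ) (t : ℝ) : ℝ :=
  (t * deriv δ t - δ t) * (4 * (δ t - t ^ 2) + 2 * (2 * δ t - t * deriv δ t)) / t

lemma gap_ae_eq (hδ : IsLSL δ) :
    ∀ᵐ t : ℝ, t ∈ Ioo (0:ℝ) 1 →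
      gap δ t = 2 * deriv (fun t => (δ t - t ^ 2) ^ 2) t - 4 * (δ t ^ 2 / t) + 12 * (t * δ t)
        - 8 * t ^ 3 + 2 * ((t * deriv δ t - δ t) * (2 * δ t - t * deriv δ t) / t) := by
  filter_upwards [hδ.ae_deriv_bounds] with t hb ht
  have hd := ((hb ht).1.sub (hasDerivAt_pow 2 t)).pow 2
  have hd' : deriv (fun t => (δ t - t ^ 2) ^ 2) t
      = 2 * (δ t - t ^ 2) * (deriv δ t - 2 * t) := by
    refine Eq.trans hd.deriv ?_
    simp
  have hne : t ≠ 0 := ht.1.ne'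
  rw [hd', gap]
  field_simp
  ring

lemma intervalIntegrable_gap_and_integral (hδ : IsLSL δ) :
    IntervalIntegrable (gap δ) volume 0 1 ∧
      ∫ t in (0:ℝ)..1, gap δ t = rhoLSL δ - xiLSL δ := by
  have hae : ∀ᵐ t : ℝ, t ∈ uIoc (0:ℝ) 1 →
      2 * deriv (fun t => (δ t - t ^ 2) ^ 2) t - 4 * (δ t ^ 2 / t) + 12 * (t * δ t)
        - 8 * t ^ 3 + 2 * ((t * deriv δ t - δ t) * (2 * δ t - t * deriv δ t) / t)
      = gap δ t := by
    filter_upwards [hδ.gap_ae_eq, volume.ae_ne 1] with t ht hne hmem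
    rw [uIoc_of_le zero_le_one] at hmem
    exact (ht ⟨hmem.1, hmem.2.lt_of_ne hne⟩).symm
  have i1 := hδ.absolutelyContinuousOnInterval_sq.intervalIntegrable_deriv.const_mul 2
  have i2 := hδ.intervalIntegrable_sq_div.const_mul 4
  have i3 : IntervalIntegrable (fun t => 12 * (t * δ t)) volume 0 1 := by
    apply ContinuousOn.intervalIntegrable
    rw [uIcc_of_le zero_le_one]
    exact continuousOn_const.mul (continuousOn_id.mul hδ.2.1.continuousOn)
  have i4 : IntervalIntegrable (fun t : ℝ => 8 * t ^ 3) volume 0 1 :=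
    (by fun_prop : Continuous fun t : ℝ => 8 * t ^ 3).intervalIntegrable _ _
  have i5 := hδ.intervalIntegrable_xi_integrand.const_mul 2
  have i12 := i1.sub i2
  have i123 := i12.add i3
  have i1234 := i123.sub i4
  refine ⟨(i1234.add i5).congr_ae ((ae_restrict_iff' measurableSet_uIoc).2 hae), ?_⟩
  rw [← intervalIntegral.integral_congr_ae hae, intervalIntegral.integral_add i1234 i5,
    intervalIntegral.integral_sub i123 i4, intervalIntegral.integral_add i12 i3,
    intervalIntegral.integral_sub i1 i2]
  simp only [intervalIntegral.integral_const_mul,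
    hδ.absolutelyContinuousOnInterval_sq.integral_deriv_eq_sub, integral_pow]
  have h0 := hδ.2.2.2.1 0 (by simp)
  have h00 : δ 0 = 0 := le_antisymm h0.2 (by simpa using h0.1)
  rw [hδ.2.2.1, h00, rhoLSL, xiLSL, tauLSL]
  norm_num
  ring

/-- The identity `ξ(δ) = ρ(δ)` means that, a.e., `δ` is locally linear or locally quadratic,
and that it is locally linear where it lies strictly above `t²`. -/
lemma xi_eq_rho_iff_ae (hδ : IsLSL δ) :
    xiLSL δ = rhoLSL δ ↔ ∀ᵐ t : ℝ, t ∈ Ioo (0:ℝ) 1 →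
      t * deriv δ t = δ t ∨ (δ t = t ^ 2 ∧ t * deriv δ t = 2 * δ t) := by
  obtain ⟨hi, hint⟩ := hδ.intervalIntegrable_gap_and_integral
  rw [eq_comm, ← sub_eq_zero, ← hint, intervalIntegral.integral_of_le zero_le_one,
    integral_Ioc_eq_integral_Ioo, setIntegral_eq_zero_iff_of_nonneg_ae,
    Filter.EventuallyEq, ae_restrict_iff' measurableSet_Ioo]
  · apply Filter.eventually_congr
    filter_upwards [hδ.ae_deriv_bounds] with t hb
    refine forall_congr' fun ht => ?_
    obtain ⟨-, hp, hq⟩ := hb ht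
    have h1 := (hδ.2.2.2.1 t (Ioo_subset_Icc_self ht)).1
    simp only [gap, Pi.zero_apply, div_eq_zero_iff, mul_eq_zero, ht.1.ne', or_false]
    refine or_congr sub_eq_zero ⟨fun h => ⟨by linarith, by linarith⟩, fun h => by linarith⟩
  · filter_upwards [ae_restrict_mem measurableSet_Ioo, ae_restrict_of_ae hδ.ae_deriv_bounds]
      with t ht hb
    obtain ⟨-, hp, hq⟩ := hb ht
    have h1 := sub_nonneg.2 (hδ.2.2.2.1 t (Ioo_subset_Icc_self ht)).1
    have hpos : 0 < t := ht.1
    simp only [gap, Pi.zero_apply]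
    positivity
  · exact (intervalIntegrable_iff_integrableOn_Ioo_of_le zero_le_one).1 hi

lemma div_eq_of_ae_linear (hδ : IsLSL δ) {s b : ℝ} (hs : 0 < s) (hsb : s ≤ b) (hb1 : b ≤ 1)
    (h : ∀ᵐ t : ℝ, t ∈ Ioo s b → t * deriv δ t = δ t) : δ s / s = δ b / b := by
  have hsub : uIcc s b ⊆ uIcc 0 1 := by
    rw [uIcc_of_le hsb, uIcc_of_le zero_le_one]
    exact Icc_subset_Icc hs.le hb1
  have hinv : AbsolutelyContinuousOnInterval (fun t : ℝ => t⁻¹) s b := by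
    apply ContDiffOn.absolutelyContinuousOnInterval
    refine contDiffOn_id.inv fun t ht => ?_
    rw [uIcc_of_le hsb] at ht
    exact (hs.trans_le ht.1).ne'
  have hac : AbsolutelyContinuousOnInterval (fun t => δ t / t) s b := by
    simpa only [div_eq_mul_inv, Pi.mul_def] using
      (hδ.absolutelyContinuousOnInterval.mono hsub).mul hinv
  obtain ⟨C, hC⟩ := hac.const_of_ae_hasDerivAt_zero <| by
    filter_upwards [hδ.ae_deriv_bounds, h, volume.ae_ne s, volume.ae_ne b]
      with t hd hlin hts htb ht
    rw [uIcc_of_le hsb] at ht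
    have hst := ht.1.lt_of_ne' hts
    have htb' := ht.2.lt_of_ne htb
    have hpos := hs.trans hst
    refine ((hd ⟨hpos, htb'.trans_le hb1⟩).1.div (hasDerivAt_id' t) hpos.ne').congr_deriv ?_
    rw [← hlin ⟨hst, htb'⟩]
    ring
  exact (hC s left_mem_uIcc).trans (hC b right_mem_uIcc).symm

lemma exists_eq_lDiag_of_ae (hδ : IsLSL δ)
    (h : ∀ᵐ t : ℝ, t ∈ Ioo (0:ℝ) 1 →
      t * deriv δ t = δ t ∨ (δ t = t ^ 2 ∧ t * deriv δ t = 2 * δ t)) :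
    ∃ a ∈ Icc (0:ℝ) 1, ∀ t ∈ Icc (0:ℝ) 1, δ t = lDiag a t := by
  set S : Set ℝ := {t ∈ Ioc (0:ℝ) 1 | δ t = t ^ 2}
  have h1S : (1:ℝ) ∈ S := ⟨by simp, by simpa using hδ.2.2.1⟩
  have hSbdd : BddBelow S := ⟨0, fun t ht => ht.1.1.le⟩
  have hb0 : 0 ≤ sInf S := le_csInf ⟨1, h1S⟩ fun t ht => ht.1.1.le
  have hb1 : sInf S ≤ 1 := csInf_le hSbdd h1S
  have hclosed : IsClosed {t ∈ Icc (0:ℝ) 1 | δ t = t ^ 2} := by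
    apply isClosed_Icc.isClosed_eq hδ.2.1.continuousOn (continuous_pow 2).continuousOn
  have hSsub : S ⊆ {t ∈ Icc (0:ℝ) 1 | δ t = t ^ 2} := fun t ht =>
    ⟨Ioc_subset_Icc_self ht.1, ht.2⟩
  have hb : δ (sInf S) = sInf S ^ 2 :=
    (closure_minimal hSsub hclosed (csInf_mem_closure ⟨1, h1S⟩ hSbdd)).2
  refine ⟨sInf S, ⟨hb0, hb1⟩, fun t ht => ?_⟩
  rcases le_or_gt t (sInf S) with htb | htb
  · rw [lDiag, if_pos htb]
    rcases ht.1.eq_or_lt with rfl | hpos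
    · have h0 := hδ.2.2.2.1 0 (by simp)
      rw [mul_zero]
      exact le_antisymm h0.2 (by simpa using h0.1)
    · have hlin : ∀ᵐ u : ℝ, u ∈ Ioo t (sInf S) → u * deriv δ u = δ u := by
        filter_upwards [h] with u hu htu
        have hu01 : u ∈ Ioo (0:ℝ) 1 := ⟨hpos.trans htu.1, htu.2.trans_le hb1⟩
        refine (hu hu01).resolve_right fun hS => ?_
        exact notMem_of_lt_csInf htu.2 hSbdd ⟨Ioo_subset_Ioc_self hu01, hS.1⟩
      have hdiv := hδ.div_eq_of_ae_linear hpos htb hb1 hlin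
      have hbpos := hpos.trans_le htb
      rw [hb, sq, mul_div_cancel_right₀ _ hbpos.ne', div_eq_iff hpos.ne'] at hdiv
      exact hdiv
  · rw [lDiag, if_neg htb.not_ge]
    obtain ⟨s, hs, hst⟩ := exists_lt_of_csInf_lt ⟨1, h1S⟩ htb
    have hpos : 0 < t := hs.1.1.trans hst
    have hanti := hδ.2.2.2.2.2 hs.1 ⟨hpos, ht.2⟩ hst.le
    simp only [hs.2, div_self (pow_pos hs.1.1 2).ne'] at hanti
    rw [div_le_one (by positivity)] at hanti
    exact le_antisymm hanti (hδ.2.2.2.1 t ht).1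

end IsLSL

/-- The diagonal `l_a` is linear below `a` and equals `t²` above `a`. -/
lemma ae_of_eq_lDiag {δ : ℝ → ℝ} {a : ℝ} (h : ∀ t ∈ Icc (0:ℝ) 1, δ t = lDiag a t) :
    ∀ᵐ t : ℝ, t ∈ Ioo (0:ℝ) 1 →
      t * deriv δ t = δ t ∨ (δ t = t ^ 2 ∧ t * deriv δ t = 2 * δ t) := by
  filter_upwards [volume.ae_ne a] with t hta ht
  rcases hta.lt_or_gt with hlt | hgt
  · have heq : δ =ᶠ[nhds t] fun u => a * u := by
      filter_upwards [Icc_mem_nhds ht.1 ht.2, Iio_mem_nhds hlt] with u hu hua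
      rw [h u hu, lDiag, if_pos (le_of_lt hua)]
    left
    rw [heq.deriv_eq, heq.eq_of_nhds, deriv_const_mul_field, deriv_id'']
    ring
  · have heq : δ =ᶠ[nhds t] fun u => u ^ 2 := by
      filter_upwards [Icc_mem_nhds ht.1 ht.2, Ioi_mem_nhds hgt] with u hu hua
      rw [h u hu, lDiag, if_neg (not_le_of_gt hua)]
    right
    rw [heq.deriv_eq, heq.eq_of_nhds, (hasDerivAt_pow 2 t).deriv]
    exact ⟨rfl, by norm_num; ring⟩

/-- `ξ(δ) = ρ(δ)` holds iff `δ = l_a` for some `a ∈ [0,1]`. -/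
theorem xi_eq_rho_iff (δ : ℝ → ℝ) (hδ : IsLSL δ) :
    xiLSL δ = rhoLSL δ ↔
    ∃ a ∈ Icc (0:ℝ) 1, ∀ t ∈ Icc (0:ℝ) 1, δ t = lDiag a t := by
  rw [hδ.xi_eq_rho_iff_ae]
  exact ⟨hδ.exists_eq_lDiag_of_ae, fun ⟨_, _, h⟩ => ae_of_eq_lDiag h⟩
end
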